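/- arXiv:1708.07597 — 2 statements merged into one kernel-verified Lean document; each statement's English description precedes it below -/
import Mathlib

section
/- The spectrum of S(k,q), i.e., the multiset of eigenvalues (with multiplicity) of the adjacency matrix of S(k,q), equals the multiset { λ_w : w = (w_1,…,w_k) ∈ F_q^k }. -/
/-- `λ_w = Σ_{a ∈ F_q^*, u ∈ F_q} ζ_p^{Tr(a w_1 + a u w_2 + Σ_{i=3}^k g_i(a) f_i(u) w_i)}`,
where `ζ_p = exp(2πi/p)` and `Tr : F_q → F_p` is the absolute trace. Coordinates are
indexed by `Fin k`, with index `0` playing the role of `1`, index `1` the role of `2`, and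
indices `i` with `2 ≤ i` the roles of `3,…,k`. -/
noncomputable def lamW (p : ℕ) {k : ℕ} (F : Type) [Field F] [Fintype F] [DecidableEq F]
    [Algebra (ZMod p) F] (hk : 3 ≤ k) (f g : Fin k → Polynomial F) (w : Fin k → F) : ℂ :=
  ∑ a ∈ Finset.univ.filter (fun a : F => a ≠ 0), ∑ u : F,
    Complex.exp (2 * Real.pi * Complex.I / p) ^
      (Algebra.trace (ZMod p) F
        (a * w ⟨0, by omega⟩ + a * u * w ⟨1, by omega⟩ +
          ∑ i ∈ Finset.univ.filter (fun i : Fin k => 2 ≤ (i : ℕ)),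
            (g i).eval a * (f i).eval u * w i)).val

/-- If an invertible matrix `V` diagonalizes `A` with diagonal `d`, the roots of the characteristic
polynomial of `A` are the entries of `d`. -/
theorem Matrix.roots_charpoly_of_mul_eq_mul_diagonal {n K : Type*} [Fintype n] [DecidableEq n]
    [Field K] {A V : Matrix n n K} {d : n → K} (hV : IsUnit V)
    (h : A * V = V * Matrix.diagonal d) : A.charpoly.roots = Finset.univ.val.map d := by
  obtain ⟨V, rfl⟩ := hV
  have hA : A = V.val * (Matrix.diagonal d * V.inv) := by
    rw [← Matrix.mul_assoc, ← h, Matrix.mul_assoc, V.val_inv, Matrix.mul_one]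
  rw [hA, Matrix.charpoly_mul_comm, Matrix.mul_assoc, V.inv_val, Matrix.mul_one,
    Matrix.charpoly_diagonal]
  simpa only [Multiset.map_map, Function.comp_def, Finset.prod] using
    Polynomial.roots_multiset_prod_X_sub_C (Finset.univ.val.map d)

/-- An additive character turns sums into products. -/
theorem AddChar.map_finset_sum_eq_prod {ι A M : Type*} [AddCommMonoid A] [CommMonoid M]
    (ψ : AddChar A M) (s : Finset ι) (x : ι → A) : ψ (∑ i ∈ s, x i) = ∏ i ∈ s, ψ (x i) := by
  classical
  induction s using Finset.induction_on with
  | empty => simp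
  | insert i s hi ih => rw [Finset.sum_insert hi, Finset.prod_insert hi, ψ.map_add_eq_mul, ih]

/-- Orthogonality of the characters `w ↦ ψ (v ⬝ᵥ w)` of a finite power of a finite ring. -/
theorem AddChar.IsPrimitive.sum_dotProduct {ι R K : Type*} [Fintype ι] [DecidableEq ι]
    [CommRing R] [Fintype R] [DecidableEq R] [Field K] {ψ : AddChar R K} (hψ : ψ.IsPrimitive)
    (v : ι → R) :
    ∑ w : ι → R, ψ (w ⬝ᵥ v) = if v = 0 then (Fintype.card R : K) ^ Fintype.card ι else 0 := by
  have h : ∑ w : ι → R, ψ (w ⬝ᵥ v) = ∏ i, ∑ x : R, ψ (x * v i) := by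
    rw [Fintype.prod_sum]
    exact Finset.sum_congr rfl fun w _ => ψ.map_finset_sum_eq_prod _ _
  rw [h]
  simp only [AddChar.sum_mulShift _ hψ]
  split_ifs with hv
  · simp [hv]
  · obtain ⟨i, hi⟩ := Function.ne_iff.mp hv
    exact Finset.prod_eq_zero (Finset.mem_univ i) (by
      rw [if_neg (by simpa using hi), Nat.cast_zero])

/-- The character table of a finite power of a finite ring is invertible. -/
theorem AddChar.IsPrimitive.isUnit_of_dotProduct {ι R K : Type*} [Fintype ι] [DecidableEq ι]
    [CommRing R] [Fintype R] [DecidableEq R] [Field K] {ψ : AddChar R K} (hψ : ψ.IsPrimitive)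
    (hR : (Fintype.card R : K) ≠ 0) :
    IsUnit (Matrix.of fun v w : ι → R => ψ (v ⬝ᵥ w)) := by
  set V : Matrix (ι → R) (ι → R) K := Matrix.of fun v w => ψ (v ⬝ᵥ w)
  set W : Matrix (ι → R) (ι → R) K := Matrix.of fun w v => ψ (w ⬝ᵥ (-v))
  have hVW : V * W = ((Fintype.card R : K) ^ Fintype.card ι) • (1 : Matrix (ι → R) (ι → R) K) := by
    ext a b
    have h : ∀ w : ι → R, V a w * W w b = ψ (w ⬝ᵥ (a - b)) := fun w => by
      simp only [V, W, Matrix.of_apply]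
      rw [← ψ.map_add_eq_mul, dotProduct_comm a w, ← dotProduct_add, sub_eq_add_neg]
    rw [Matrix.mul_apply, Finset.sum_congr rfl fun w _ => h w, hψ.sum_dotProduct]
    simp [Matrix.one_apply, sub_eq_zero]
  refine IsUnit.of_mul_eq_one
    ((((Fintype.card R : K) ^ Fintype.card ι)⁻¹) • W) ?_
  rw [Matrix.mul_smul, hVW, smul_smul, inv_mul_cancel₀ (pow_ne_zero _ hR), one_smul]

/-- The spectrum of a translation-invariant matrix on a finite power of a finite ring consists of
the Fourier coefficients of its defining function. -/
theorem AddChar.IsPrimitive.roots_charpoly_of_sub {ι R K : Type*} [Fintype ι] [DecidableEq ι]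
    [CommRing R] [Fintype R] [DecidableEq R] [Field K] {ψ : AddChar R K} (hψ : ψ.IsPrimitive)
    (hR : (Fintype.card R : K) ≠ 0) (φ : (ι → R) → K) :
    (Matrix.of fun a b : ι → R => φ (b - a)).charpoly.roots =
      Finset.univ.val.map fun w : ι → R => ∑ d, φ d * ψ (d ⬝ᵥ w) := by
  refine Matrix.roots_charpoly_of_mul_eq_mul_diagonal (hψ.isUnit_of_dotProduct hR) ?_
  ext a w
  rw [Matrix.mul_apply, Matrix.mul_diagonal, Finset.mul_sum,
    ← Equiv.sum_comp (Equiv.addRight a)]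
  refine Finset.sum_congr rfl fun d _ => ?_
  simp only [Matrix.of_apply, Equiv.coe_addRight, add_sub_cancel_right, add_dotProduct,
    ψ.map_add_eq_mul]
  ring

/-- The trace composed with a primitive character of `ZMod p` is a primitive character. -/
theorem AddChar.IsPrimitive.compTrace {p : ℕ} [Fact p.Prime] {F M : Type*} [Field F] [Finite F]
    [Algebra (ZMod p) F] [CommMonoid M] {χ : AddChar (ZMod p) M} (hχ : χ.IsPrimitive) :
    (χ.compAddMonoidHom (Algebra.trace (ZMod p) F).toAddMonoidHom).IsPrimitive := by
  refine AddChar.IsPrimitive.of_ne_one fun h => hχ one_ne_zero ?_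
  ext x
  obtain ⟨y, rfl⟩ := Algebra.trace_surjective (ZMod p) F x
  simpa using DFunLike.congr_fun h y

/-- The sum over `Fin k` separates into the first two terms and the remaining ones. -/
theorem Fin.sum_eq_add_add_sum_filter_two_le {M : Type*} [AddCommMonoid M] {k : ℕ} (hk : 2 ≤ k)
    (x : Fin k → M) :
    ∑ i, x i = x ⟨0, by omega⟩ + x ⟨1, by omega⟩ +
      ∑ i ∈ Finset.univ.filter (fun i : Fin k => 2 ≤ (i : ℕ)), x i := by
  have h : Finset.univ.filter (fun i : Fin k => ¬ 2 ≤ (i : ℕ)) =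
      {⟨0, by omega⟩, ⟨1, by omega⟩} := by
    ext i
    simp only [Finset.mem_filter, Finset.mem_univ, true_and, Finset.mem_insert,
      Finset.mem_singleton, Fin.ext_iff]
    omega
  rw [← Finset.sum_filter_not_add_sum_filter _ (fun i : Fin k => 2 ≤ (i : ℕ)), h,
    Finset.sum_pair (by simp)]

/-- The difference `b - a` of the adjacent vertices `a`, `b` of `S(k,q)` with `b_1 - a_1 = x` and
`(b_2 - a_2) / (b_1 - a_1) = u`. -/
noncomputable def edgeVector {F : Type*} [Field F] {k : ℕ} (f g : Fin k → Polynomial F)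
    (x u : F) (i : Fin k) : F :=
  if (i : ℕ) = 0 then x else if (i : ℕ) = 1 then x * u else (g i).eval x * (f i).eval u

theorem edgeVector_of_two_le {F : Type*} [Field F] {k : ℕ} (f g : Fin k → Polynomial F)
    (x u : F) {i : Fin k} (hi : 2 ≤ (i : ℕ)) :
    edgeVector f g x u i = (g i).eval x * (f i).eval u := by
  rw [edgeVector, if_neg (by omega), if_neg (by omega)]

theorem edgeVector_dotProduct {F : Type*} [Field F] {k : ℕ} (hk : 2 ≤ k)
    (f g : Fin k → Polynomial F) (x u : F) (w : Fin k → F) :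
    edgeVector f g x u ⬝ᵥ w = x * w ⟨0, by omega⟩ + x * u * w ⟨1, by omega⟩ +
      ∑ i ∈ Finset.univ.filter (fun i : Fin k => 2 ≤ (i : ℕ)),
        (g i).eval x * (f i).eval u * w i := by
  rw [dotProduct, Fin.sum_eq_add_add_sum_filter_two_le hk]
  congr 1
  exact Finset.sum_congr rfl fun i hi => by
    rw [edgeVector_of_two_le f g x u (Finset.mem_filter.mp hi).2]

/-- The differences of adjacent vertices are parametrized by `edgeVector`. -/
theorem sum_filter_eq_sum_edgeVector {F M : Type*} [Field F] [Fintype F] [DecidableEq F]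
    [AddCommMonoid M] {k : ℕ} (hk : 2 ≤ k) (f g : Fin k → Polynomial F)
    (P : (Fin k → F) → Prop) [DecidablePred P]
    (hP : ∀ d, P d ↔ d ⟨0, by omega⟩ ≠ 0 ∧ ∀ i : Fin k, 2 ≤ (i : ℕ) →
      d i = (g i).eval (d ⟨0, by omega⟩) * (f i).eval (d ⟨1, by omega⟩ / d ⟨0, by omega⟩))
    (h : (Fin k → F) → M) :
    ∑ d ∈ Finset.univ.filter P, h d =
      ∑ x ∈ Finset.univ.filter (fun x : F => x ≠ 0), ∑ u : F, h (edgeVector f g x u) := by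
  rw [← Finset.sum_product']
  have key : ∀ d, P d →
      edgeVector f g (d ⟨0, by omega⟩) (d ⟨1, by omega⟩ / d ⟨0, by omega⟩) = d := by
    intro d hd
    obtain ⟨h0, hi⟩ := (hP d).mp hd
    funext i
    by_cases hi2 : 2 ≤ (i : ℕ)
    · rw [edgeVector_of_two_le f g _ _ hi2, hi i hi2]
    · obtain h | h : i = ⟨0, by omega⟩ ∨ i = ⟨1, by omega⟩ := by
        simp only [Fin.ext_iff]; omega
      · simp [h, edgeVector]
      · simp [h, edgeVector, mul_div_cancel₀ _ h0]
  refine Finset.sum_bij' (fun d _ => (d ⟨0, by omega⟩, d ⟨1, by omega⟩ / d ⟨0, by omega⟩))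
    (fun z _ => edgeVector f g z.1 z.2) ?_ ?_ ?_ ?_ ?_
  · intro d hd
    simpa using ((hP d).mp (Finset.mem_filter.mp hd).2).1
  · rintro ⟨x, u⟩ hz
    have hx : x ≠ 0 := by simpa using hz
    refine Finset.mem_filter.mpr ⟨Finset.mem_univ _, (hP _).mpr ⟨by simpa [edgeVector], ?_⟩⟩
    intro i hi
    rw [edgeVector_of_two_le f g _ _ hi]
    simp [edgeVector, hx]
  · intro d hd
    exact key d (Finset.mem_filter.mp hd).2
  · rintro ⟨x, u⟩ hz
    have hx : x ≠ 0 := by simpa using hz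
    simp [edgeVector, hx]
  · intro d hd
    simp only [key d (Finset.mem_filter.mp hd).2]


/-- The spectrum of `S(k,q)` (the multiset of eigenvalues, with multiplicity,
of its adjacency matrix, i.e. the multiset of roots of its characteristic polynomial over `ℂ`)
equals the multiset `{ λ_w : w ∈ F_q^k }`. -/
theorem stmt_1 (p e q k : ℕ) (hp : p.Prime) (he : 1 ≤ e) (hq : q = p ^ e) (hk : 3 ≤ k)
    (F : Type) [Field F] [Fintype F] [DecidableEq F] [Algebra (ZMod p) F]
    (hcard : Fintype.card F = q)
    (f g : Fin k → Polynomial F)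
    (hdegf : ∀ i : Fin k, 2 ≤ (i : ℕ) → (f i).natDegree ≤ q - 1)
    (hdegg : ∀ i : Fin k, 2 ≤ (i : ℕ) → (g i).natDegree ≤ q - 1)
    (hodd : ∀ i : Fin k, 2 ≤ (i : ℕ) → (g i).comp (-Polynomial.X) = -(g i))
    (G : SimpleGraph (Fin k → F)) [DecidableRel G.Adj]
    (hAdj : ∀ a b : Fin k → F, G.Adj a b ↔
      (a ⟨0, by omega⟩ ≠ b ⟨0, by omega⟩ ∧ ∀ i : Fin k, 2 ≤ (i : ℕ) →
        b i - a i = (g i).eval (b ⟨0, by omega⟩ - a ⟨0, by omega⟩) *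
          (f i).eval ((b ⟨1, by omega⟩ - a ⟨1, by omega⟩) / (b ⟨0, by omega⟩ - a ⟨0, by omega⟩)))) :
    (G.adjMatrix ℂ).charpoly.roots =
      Finset.univ.val.map (fun w : Fin k → F => lamW p F hk f g w) := by
  have : Fact p.Prime := ⟨hp⟩
  have hχ := AddChar.zmodChar_primitive_of_primitive_root p
    (Complex.isPrimitiveRoot_exp p hp.ne_zero)
  have hψ := hχ.compTrace (F := F)
  set P : (Fin k → F) → Prop := fun d => d ⟨0, by omega⟩ ≠ 0 ∧ ∀ i : Fin k, 2 ≤ (i : ℕ) →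
    d i = (g i).eval (d ⟨0, by omega⟩) * (f i).eval (d ⟨1, by omega⟩ / d ⟨0, by omega⟩) with hP
  classical
  have hA : G.adjMatrix ℂ =
      Matrix.of fun a b : Fin k → F => if P (b - a) then (1 : ℂ) else 0 := by
    ext a b
    simp only [SimpleGraph.adjMatrix_apply, Matrix.of_apply]
    refine if_congr ((hAdj a b).trans ?_) rfl rfl
    simp only [hP, Pi.sub_apply, ne_eq, sub_eq_zero, eq_comm (a := a ⟨0, _⟩)]
  rw [hA, hψ.roots_charpoly_of_sub (Nat.cast_ne_zero.mpr Fintype.card_ne_zero)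
    (fun d => if P d then (1 : ℂ) else 0)]
  refine congrArg (fun φ => Finset.univ.val.map φ) (funext fun w => ?_)
  simp only [ite_mul, one_mul, zero_mul]
  rw [← Finset.sum_filter, sum_filter_eq_sum_edgeVector (by omega) f g P fun d => Iff.rfl]
  simp only [edgeVector_dotProduct (show 2 ≤ k by omega)]
  rfl
end

section
/- Assume k ≥ 3, d_f ≥ 1 and 1 ≤ d_g < p, and that at least one of the following holds: (1) the polynomials 1, X, f_3, …, f_k are linearly independent over F_q and each g_i (3 ≤ i ≤ k) has a nonzero coefficient of X; (2) the polynomials f_3, …, f_k are linearly independent over F_q and there exists j with 2 ≤ j ≤ d_g such that the coefficient c_{i,j} of X^j in g_i is nonzero for every 3 ≤ i ≤ k. Then the graph S(k,q) is connected. -/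
/-- Every `ZMod p`-linear functional on `F^ι`, for a finite field `F`, is of the form
`x ↦ Tr (∑ i, w i * x i)`. -/
lemma exists_eq_trace_sum_mul {p : ℕ} [Fact p.Prime] {F : Type*} [Field F] [Finite F]
    [Algebra (ZMod p) F] {ι : Type*} [Fintype ι] (φ : (ι → F) →ₗ[ZMod p] ZMod p) :
    ∃ w : ι → F, ∀ x, φ x = Algebra.trace (ZMod p) F (∑ i, w i * x i) := by
  classical
  have hnd := traceForm_nondegenerate (ZMod p) F
  refine ⟨fun i => (LinearMap.BilinForm.toDual _ hnd).symm
    (φ ∘ₗ LinearMap.single (ZMod p) (fun _ : ι => F) i), fun x => ?_⟩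
  rw [map_sum]
  conv_lhs => rw [← Finset.univ_sum_single x, map_sum]
  refine Finset.sum_congr rfl fun i _ => ?_
  rw [← Algebra.traceForm_apply, ← LinearMap.BilinForm.toDual_def hnd,
    LinearEquiv.apply_symm_apply]
  rfl

open Polynomial in
/-- If `P` has degree less than `p` and `Tr (P t) = 0` for all nonzero `t`, then the coefficients
of `P` of positive degree vanish. -/
lemma coeff_eq_zero_of_trace_eval_eq_zero {p : ℕ} [Fact p.Prime] {F : Type*} [Field F] [Fintype F]
    [Algebra (ZMod p) F] (P : F[X]) (hP : P.natDegree < p)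
    (htr : ∀ t : F, t ≠ 0 → Algebra.trace (ZMod p) F (P.eval t) = 0)
    (hzero : P.coeff 0 = 0 ∨ 2 ≤ Module.finrank (ZMod p) F) {j : ℕ} (hj : 0 < j) (hjp : j < p) :
    P.coeff j = 0 := by
  classical
  have hp : p.Prime := Fact.out
  have : CharP F p := charP_of_injective_algebraMap (algebraMap (ZMod p) F).injective p
  have hcard : Fintype.card F = p ^ Module.finrank (ZMod p) F := by
    rw [Module.card_eq_pow_finrank (K := ZMod p), ZMod.card]
  have hn : 1 ≤ Module.finrank (ZMod p) F := Module.finrank_pos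
  generalize hm : Module.finrank (ZMod p) F = n at *
  set Q : F[X] := ∑ m ∈ Finset.range n, P ^ p ^ m with hQ
  have heval (t : F) : Q.eval t = algebraMap (ZMod p) F (Algebra.trace (ZMod p) F (P.eval t)) := by
    rw [FiniteField.algebraMap_trace_eq_sum_pow, hm, Nat.card_zmod, hQ, eval_finsetSum]
    simp
  have hQne (t : F) (ht : t ≠ 0) : Q.eval t = 0 := by rw [heval, htr t ht, map_zero]
  have hdeg : Q.natDegree ≤ (p - 1) * p ^ (n - 1) := by
    refine natDegree_sum_le_of_forall_le _ _ fun m hmn => natDegree_pow_le.trans ?_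
    rw [mul_comm]
    have := Finset.mem_range.1 hmn
    exact Nat.mul_le_mul (by omega) (Nat.pow_le_pow_right hp.pos (by omega))
  have hpow : (p - 1) * p ^ (n - 1) + p ^ (n - 1) = p ^ n := by
    obtain ⟨r, rfl⟩ : ∃ r, p = r + 1 := ⟨p - 1, by have := hp.pos; omega⟩
    obtain ⟨s, rfl⟩ : ∃ s, n = s + 1 := ⟨n - 1, by omega⟩
    simp only [Nat.add_sub_cancel]
    ring
  have hQ0 : Q = 0 := by
    rcases hzero with h0 | h2
    · refine eq_zero_of_natDegree_lt_card_of_eval_eq_zero Q Function.injective_id (fun t => ?_) ?_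
      · by_cases ht : t = 0
        · rw [id, heval, ht, ← coeff_zero_eq_eval_zero, h0, map_zero, map_zero]
        · exact hQne t ht
      · have : 0 < p ^ (n - 1) := pow_pos hp.pos _
        omega
    · refine eq_zero_of_natDegree_lt_card_of_eval_eq_zero' Q (Finset.univ.erase 0)
        (fun t ht => hQne t (Finset.ne_of_mem_erase ht)) ?_
      have : 1 < p ^ (n - 1) := Nat.one_lt_pow (by omega) hp.one_lt
      rw [Finset.card_erase_of_mem (Finset.mem_univ _), Finset.card_univ]
      omega
  have hcoeff : Q.coeff j = P.coeff j := by
    rw [hQ, finsetSum_coeff, Finset.sum_eq_single_of_mem 0 (Finset.mem_range.2 hn)]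
    · simp
    · intro m _ hm0
      rw [← map_iterateFrobenius_expand p P m, coeff_map, coeff_expand (pow_pos hp.pos m), if_neg,
        map_zero]
      exact fun h => Nat.not_dvd_of_pos_of_lt hj hjp ((dvd_pow_self p hm0).trans h)
  rw [← hcoeff, hQ0, coeff_zero]

open Polynomial in
/-- Linearly independent polynomials of degree less than the cardinality of a finite field remain
linearly independent as functions. -/
lemma linearIndependent_eval {F ι : Type*} [Field F] [Fintype F] {v : ι → F[X]}
    (hv : LinearIndependent F v) (hdeg : ∀ i, (v i).natDegree < Fintype.card F) :
    LinearIndependent F (fun i (u : F) => (v i).eval u) := by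
  rw [linearIndependent_iff'] at hv ⊢
  intro s c hc
  refine hv s c (eq_zero_of_natDegree_lt_card_of_eval_eq_zero _ Function.injective_id
    (fun u => ?_) ?_)
  · simpa [eval_finsetSum] using congrFun hc u
  · refine (Nat.lt_iff_le_pred Fintype.card_pos).2 ?_
    exact natDegree_sum_le_of_forall_le _ _ fun i _ =>
      (natDegree_smul_le _ _).trans (Nat.le_pred_of_lt (hdeg i))

open Polynomial in
lemma eq_zero_of_sum_mul_eval_eq_zero {F ι : Type*} [Field F] [Fintype F] [Fintype ι] {v : ι → F[X]}
    (hv : LinearIndependent F v) (hdeg : ∀ i, (v i).natDegree < Fintype.card F) {c : ι → F}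
    (hc : ∀ u, ∑ i, c i * (v i).eval u = 0) (i : ι) : c i = 0 := by
  have hli := linearIndependent_eval hv hdeg
  rw [Fintype.linearIndependent_iff] at hli
  refine hli c ?_ i
  funext u
  simpa using hc u

open Polynomial in
/-- An additive subgroup of `F^ι` containing all vectors `(f i u * g i t)_i` with `t ≠ 0` is
everything, provided that the functions `∑ i, w i * c i j * f i`, where `c i j` are the
coefficients of `g i`, vanish simultaneously for `0 < j < p` only when `w = 0`. -/
lemma addSubgroup_eq_top_of_eval_mul_eval_mem {p : ℕ} [Fact p.Prime] {F : Type*} [Field F]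
    [Fintype F] [CharP F p] {ι : Type*} [Fintype ι] (f g : ι → F[X])
    (hg : ∀ i, (g i).natDegree < p)
    (hzero : (∀ i, (g i).coeff 0 = 0) ∨ p < Fintype.card F)
    (hw : ∀ w : ι → F,
      (∀ j, 0 < j → j < p → ∀ u, ∑ i, w i * (g i).coeff j * (f i).eval u = 0) → w = 0)
    (H : AddSubgroup (ι → F))
    (hH : ∀ t u : F, t ≠ 0 → (fun i => (f i).eval u * (g i).eval t) ∈ H) : H = ⊤ := by
  have hp : p.Prime := Fact.out
  let _ : Algebra (ZMod p) F := ZMod.algebra F p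
  by_contra hne
  have hlt : AddSubgroup.toZModSubmodule p H < ⊤ := by
    refine lt_top_iff_ne_top.2 fun h => hne ?_
    rwa [map_eq_top_iff] at h
  obtain ⟨φ, hφ0, hφ⟩ := Submodule.exists_le_ker_of_lt_top _ hlt
  obtain ⟨w, hφw⟩ := exists_eq_trace_sum_mul φ
  refine hφ0 (LinearMap.ext fun x => ?_)
  suffices hw0 : w = 0 by simp [hφw, hw0]
  refine hw w fun j hj hjp u => ?_
  have hcoeff (m : ℕ) : (∑ i, C (w i * (f i).eval u) * g i).coeff m =
      ∑ i, w i * (g i).coeff m * (f i).eval u := by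
    simp only [finsetSum_coeff, coeff_C_mul]
    exact Finset.sum_congr rfl fun i _ => by ring
  rw [← hcoeff]
  refine coeff_eq_zero_of_trace_eval_eq_zero _ ?_ (fun t ht => ?_) ?_ hj hjp
  · refine (Nat.lt_iff_le_pred hp.pos).2 ?_
    exact natDegree_sum_le_of_forall_le _ _ fun i _ =>
      (natDegree_C_mul_le _ _).trans (Nat.le_pred_of_lt (hg i))
  · have hmem := LinearMap.mem_ker.1 (hφ (hH t u ht))
    rw [hφw] at hmem
    rw [← hmem, eval_finsetSum]
    simp [mul_assoc]
  · refine hzero.imp (fun h => by simp [h]) fun h => ?_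
    rw [Module.card_eq_pow_finrank (K := ZMod p), ZMod.card] at h
    by_contra hlt2
    have : p ^ Module.finrank (ZMod p) F ≤ p ^ 1 := Nat.pow_le_pow_right hp.pos (by omega)
    rw [pow_one] at this
    omega

/-- The translations of an additive group that do not leave any connected component of a graph. -/
def SimpleGraph.reachableTranslations {V : Type*} [AddCommGroup V] (G : SimpleGraph V) :
    AddSubgroup V where
  carrier := {d | ∀ a, G.Reachable a (a + d)}
  zero_mem' a := by rw [add_zero]
  add_mem' {c d} hc hd a := by
    rw [← add_assoc]
    exact (hc a).trans (hd (a + c))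
  neg_mem' {d} hd a := by
    have := hd (a + -d)
    rw [neg_add_cancel_right] at this
    exact this.symm

lemma SimpleGraph.connected_of_reachableTranslations_eq_top {V : Type*} [AddCommGroup V]
    {G : SimpleGraph V} (h : G.reachableTranslations = ⊤) : G.Connected := by
  refine ⟨fun a b => ?_⟩
  have hmem : b - a ∈ G.reachableTranslations := h ▸ AddSubgroup.mem_top _
  simpa using hmem a

/-- sufficient conditions for connectivity of `S(k,q)`. -/
theorem stmt_7 (p e q k : ℕ) (hp : p.Prime) (he : 1 ≤ e) (hq : q = p ^ e) (hk : 3 ≤ k)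
    (F : Type) [Field F] [Fintype F] [DecidableEq F] (hcard : Fintype.card F = q)
    (f g : Fin k → Polynomial F)
    (hdegf : ∀ i : Fin k, 2 ≤ (i : ℕ) → (f i).natDegree ≤ q - 1)
    (hdegg : ∀ i : Fin k, 2 ≤ (i : ℕ) → (g i).natDegree ≤ q - 1)
    (hodd : ∀ i : Fin k, 2 ≤ (i : ℕ) → (g i).comp (-Polynomial.X) = -(g i))
    (df dg : ℕ)
    (hdf : df = (Finset.univ.filter (fun i : Fin k => 2 ≤ (i : ℕ))).sup
      (fun i => (f i).natDegree))
    (hdg : dg = (Finset.univ.filter (fun i : Fin k => 2 ≤ (i : ℕ))).sup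
      (fun i => (g i).natDegree))
    (hdf1 : 1 ≤ df) (hdg1 : 1 ≤ dg) (hdgp : dg < p)
    (G : SimpleGraph (Fin k → F)) [DecidableRel G.Adj]
    (hAdj : ∀ a b : Fin k → F, G.Adj a b ↔
      (a ⟨0, by omega⟩ ≠ b ⟨0, by omega⟩ ∧ ∀ i : Fin k, 2 ≤ (i : ℕ) →
        b i - a i = (g i).eval (b ⟨0, by omega⟩ - a ⟨0, by omega⟩) *
          (f i).eval ((b ⟨1, by omega⟩ - a ⟨1, by omega⟩) / (b ⟨0, by omega⟩ - a ⟨0, by omega⟩))))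
    (hcond :
      (LinearIndependent F (fun i : Fin k =>
          if (i : ℕ) = 0 then (1 : Polynomial F)
          else if (i : ℕ) = 1 then Polynomial.X
          else f i) ∧
        ∀ i : Fin k, 2 ≤ (i : ℕ) → (g i).coeff 1 ≠ 0) ∨
      (LinearIndependent F (fun i : {i : Fin k // 2 ≤ (i : ℕ)} => f i) ∧
        ∃ j, 2 ≤ j ∧ j ≤ dg ∧ ∀ i : Fin k, 2 ≤ (i : ℕ) → (g i).coeff j ≠ 0)) :
    G.Connected := by
  have : Fact p.Prime := ⟨hp⟩
  have : CharP F p := charP_of_card_eq_prime_pow (hcard.trans hq)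
  have hq1 : 1 < q := hcard ▸ Fintype.one_lt_card
  have hgp : ∀ i : Fin k, 2 ≤ (i : ℕ) → (g i).natDegree < p := fun i hi => by
    refine lt_of_le_of_lt ?_ hdgp
    rw [hdg]
    exact Finset.le_sup (f := fun i => (g i).natDegree) (by simpa using hi)
  set f' : Fin k → Polynomial F := fun i =>
    if (i : ℕ) = 0 then 1 else if (i : ℕ) = 1 then Polynomial.X else f i with hf'
  set g' : Fin k → Polynomial F := fun i => if 2 ≤ (i : ℕ) then g i else Polynomial.X with hg'
  have hf'2 : ∀ i : Fin k, 2 ≤ (i : ℕ) → f' i = f i := fun i hi => by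
    simp only [hf']; rw [if_neg (by omega), if_neg (by omega)]
  have hg'2 : ∀ i : Fin k, 2 ≤ (i : ℕ) → g' i = g i := fun i hi => if_pos hi
  have hg'1 : ∀ i : Fin k, ¬ 2 ≤ (i : ℕ) → g' i = Polynomial.X := fun i hi => if_neg hi
  have hf'deg : ∀ i, (f' i).natDegree < Fintype.card F := fun i => by
    rw [hcard]
    by_cases hi : 2 ≤ (i : ℕ)
    · rw [hf'2 i hi]
      have := hdegf i hi
      omega
    · simp only [hf']
      split_ifs
      · simp; omega
      · simpa using hq1
      · omega
  apply SimpleGraph.connected_of_reachableTranslations_eq_top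
  refine addSubgroup_eq_top_of_eval_mul_eval_mem (p := p) f' g' ?_ ?_ ?_ _ ?_
  · intro i
    by_cases hi : 2 ≤ (i : ℕ)
    · rw [hg'2 i hi]
      exact hgp i hi
    · rw [hg'1 i hi, Polynomial.natDegree_X]
      exact hp.one_lt
  · by_cases hp2 : p = 2
    · right
      rcases hcond with ⟨hli, -⟩ | ⟨-, j, hj2, hjd, -⟩
      · have := (linearIndependent_eval hli hf'deg).fintype_card_le_finrank
        rw [Fintype.card_fin, Module.finrank_fintype_fun_eq_card] at this
        omega
      · omega
    · left
      intro i
      by_cases hi : 2 ≤ (i : ℕ)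
      · have h := congrArg (Polynomial.eval 0) (hodd i hi)
        have h2 : (2 : F) ≠ 0 := Ring.two_ne_zero (by rwa [ringChar.eq F p])
        rw [Polynomial.eval_comp, Polynomial.eval_neg, Polynomial.eval_neg, Polynomial.eval_X,
          neg_zero] at h
        rw [hg'2 i hi, Polynomial.coeff_zero_eq_eval_zero]
        refine (mul_eq_zero.1 ?_).resolve_left h2
        linear_combination h
      · rw [hg'1 i hi, Polynomial.coeff_X_zero]
  · intro w hw
    rcases hcond with ⟨hli, hc⟩ | ⟨hli, j, hj2, hjd, hc⟩
    · have h0 := eq_zero_of_sum_mul_eval_eq_zero hli hf'deg (hw 1 one_pos hp.one_lt)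
      funext i
      refine (mul_eq_zero.1 (h0 i)).resolve_right ?_
      by_cases hi : 2 ≤ (i : ℕ)
      · rw [hg'2 i hi]
        exact hc i hi
      · simp [hg'1 i hi]
    · have hfdeg : ∀ i : {i : Fin k // 2 ≤ (i : ℕ)}, (f i).natDegree < Fintype.card F := fun i => by
        rw [← hf'2 i.1 i.2]
        exact hf'deg i.1
      have h0 : ∀ i : {i : Fin k // 2 ≤ (i : ℕ)}, w i * (g' i).coeff j = 0 := by
        refine eq_zero_of_sum_mul_eval_eq_zero hli hfdeg fun u => ?_
        have hsum := hw j (by omega) (by omega) u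
        rw [← Finset.sum_subset (Finset.subset_univ {i : Fin k | 2 ≤ (i : ℕ)}),
          Finset.sum_subtype _ (p := fun i : Fin k => 2 ≤ (i : ℕ)) (by simp)] at hsum
        · rw [← hsum]
          exact Finset.sum_congr rfl fun i _ => by rw [hf'2 i.1 i.2]
        · intro i _ hi
          have hi2 : ¬ 2 ≤ (i : ℕ) := by simpa using hi
          rw [hg'1 i hi2, Polynomial.coeff_X, if_neg (by omega), mul_zero, zero_mul]
      have hw2 : ∀ i : Fin k, 2 ≤ (i : ℕ) → w i = 0 := fun i hi =>
        (mul_eq_zero.1 (h0 ⟨i, hi⟩)).resolve_right (by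
          simpa only [hg'2 i hi] using hc i hi)
      have hlin : ∀ u : F, w ⟨0, by omega⟩ + w ⟨1, by omega⟩ * u = 0 := fun u => by
        have hsum := hw 1 one_pos hp.one_lt u
        rw [Fintype.sum_eq_add (⟨0, by omega⟩ : Fin k) ⟨1, by omega⟩ (by simp)] at hsum
        · simpa [hf', hg'] using hsum
        · rintro i ⟨hi0, hi1⟩
          rw [hw2 i, zero_mul, zero_mul]
          rw [Ne, Fin.ext_iff] at hi0 hi1
          simp only at hi0 hi1
          omega
      have hw0 : w ⟨0, by omega⟩ = 0 := by simpa using hlin 0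
      have hw1 : w ⟨1, by omega⟩ = 0 := by simpa [hw0] using hlin 1
      funext i
      by_cases hi : 2 ≤ (i : ℕ)
      · exact hw2 i hi
      · obtain hi | hi : (i : ℕ) = 0 ∨ (i : ℕ) = 1 := by omega
        · rw [show i = ⟨0, by omega⟩ from Fin.ext hi, hw0, Pi.zero_apply]
        · rw [show i = ⟨1, by omega⟩ from Fin.ext hi, hw1, Pi.zero_apply]
  · intro t u ht a
    refine SimpleGraph.Adj.reachable ((hAdj _ _).2 ⟨?_, fun i hi => ?_⟩)
    · simpa [hf', hg'] using ht
    · simp only [Pi.add_apply, add_sub_cancel_left, hf'2 i hi, hg'2 i hi]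
      have h0 : (f' ⟨0, by omega⟩).eval u * (g' ⟨0, by omega⟩).eval t = t := by simp [hf', hg']
      have h1 : (f' ⟨1, by omega⟩).eval u * (g' ⟨1, by omega⟩).eval t = u * t := by
        simp [hf', hg']
      rw [h0, h1, mul_div_cancel_right₀ u ht, mul_comm]
end
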